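/- arXiv:2211.03354 — 2 statements merged into one kernel-verified Lean document; each statement's English description precedes it below -/
import Mathlib

section
/- Let λ ≠ μ be weights of type (m,n) with |λ| ≤ |μ|. Then there is at most one weight ν adjacent in Γ_m^n to both λ and μ with |ν| < |λ|; equivalently, at most one path of length 2 between λ and μ passes through a vertex of height strictly less than |λ|. -/
open scoped Classical

namespace Kh

abbrev Wt (N : ℕ) := Fin N → Bool

variable {N : ℕ}

/-- A weight of type `(m,n)`: `m` downs (`true`) and `n` ups (`false`). -/
def IsWeight (m n : ℕ) (l : Wt N) : Prop :=
  {i : Fin N | l i = true}.ncard = m ∧ {i : Fin N | l i = false}.ncard = n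

/-- The height of a weight: sum over downs of the number of ups to the left. -/
noncomputable def height (l : Wt N) : ℕ :=
  ∑ i : Fin N, if l i = true then {j : Fin N | j < i ∧ l j = false}.ncard else 0

/-- Number of positions `t` with `i < t ≤ j` and value `b`. -/
noncomputable def cnt (l : Wt N) (b : Bool) (i j : Fin N) : ℕ :=
  {t : Fin N | i < t ∧ t ≤ j ∧ l t = b}.ncard

/-- `(i,j)` is a matched pair ("circle") of the standard non-crossing bracket matching
of `l` (reading `true` = ↓ as an opening bracket and `false` = ↑ as a closing bracket):
`l i = ↓`, `l j = ↑`, the segment strictly between `i` and `j` is balanced and every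
prefix of it has at least as many ↓'s as ↑'s. -/
def IsCircle (l : Wt N) (i j : Fin N) : Prop :=
  i < j ∧ l i = true ∧ l j = false ∧
    cnt l true i j + 1 = cnt l false i j ∧
    ∀ k : Fin N, i < k → k < j → cnt l false i k ≤ cnt l true i k

/-- `s_C(λ)`: exchange the values of `l` at the two positions of the circle `C = (i,j)`. -/
def swapC (l : Wt N) (i j : Fin N) : Wt N :=
  fun t => if t = i then l j else if t = j then l i else l t

/-- The circle `(i,j)` encloses the circle `(i',j')`. -/
def Encloses (i j i' j' : Fin N) : Prop := i < i' ∧ j' < j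

/-- The circle `(i,j)` lies to the left of the circle `(i',j')`. -/
def LeftOf (i j i' j' : Fin N) : Prop := j < i'

/-- The position `p` is unmatched in `l`. -/
def Unmatched (l : Wt N) (p : Fin N) : Prop :=
  ∀ q : Fin N, ¬ IsCircle l p q ∧ ¬ IsCircle l q p

/-- `def(λ)`: the number of circles of `l`. -/
noncomputable def defect (l : Wt N) : ℕ :=
  {p : Fin N × Fin N | IsCircle l p.1 p.2}.ncard

/-- One step up in the graph `Γ_m^n`: `m' = s_C(l)` for some circle `C` of `l`. -/
def GammaStep (l m' : Wt N) : Prop :=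
  ∃ i j : Fin N, IsCircle l i j ∧ m' = swapC l i j

/-- Adjacency in the graph `Γ_m^n`. -/
def GammaAdj (l m' : Wt N) : Prop := GammaStep l m' ∨ GammaStep m' l

/-- The order embedding `Fin N → Fin (N+2)` skipping the two positions `i`, `i+1`;
composing a weight with it deletes these two positions. -/
def skip2 (i : ℕ) {N : ℕ} (t : Fin N) : Fin (N + 2) :=
  if (t : ℕ) < i then Fin.castLE (Nat.le_add_right N 2) t
  else ⟨(t : ℕ) + 2, Nat.add_lt_add_right t.isLt 2⟩

end Kh

namespace Kh

variable {N : ℕ}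

theorem cnt_split (l : Wt N) (b : Bool) {i k j : Fin N} (h1 : i ≤ k) (h2 : k ≤ j) :
    cnt l b i j = cnt l b i k + cnt l b k j := by
  unfold cnt
  rw [← Set.ncard_union_eq _ (Set.toFinite _) (Set.toFinite _)]
  · congr 1
    ext t
    simp only [Set.mem_setOf_eq, Set.mem_union]
    constructor
    · rintro ⟨ha, hb, hc⟩
      rcases le_or_gt t k with h | h
      · exact Or.inl ⟨ha, h, hc⟩
      · exact Or.inr ⟨h, hb, hc⟩
    · rintro (⟨ha, hb, hc⟩ | ⟨ha, hb, hc⟩)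
      · exact ⟨ha, hb.trans h2, hc⟩
      · exact ⟨h1.trans_lt ha, hb, hc⟩
  · rw [Set.disjoint_left]
    rintro t ⟨_, hb, _⟩ ⟨ha, _, _⟩
    exact absurd ha (not_lt.mpr hb)

theorem cnt_self (l : Wt N) (b : Bool) (i : Fin N) : cnt l b i i = 0 := by
  unfold cnt
  rw [Set.ncard_eq_zero]
  ext t
  simp only [Set.mem_setOf_eq, Set.mem_empty_iff_false, iff_false]
  rintro ⟨ha, hb, _⟩
  exact absurd ha (not_lt.mpr hb)

theorem cnt_succ (l : Wt N) (b : Bool) {p k : Fin N} (h : (p : ℕ) + 1 = k) :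
    cnt l b p k = if l k = b then 1 else 0 := by
  unfold cnt
  split_ifs with hb
  · rw [Set.ncard_eq_one]
    refine ⟨k, ?_⟩
    ext t
    simp only [Set.mem_setOf_eq, Set.mem_singleton_iff, Fin.lt_def, Fin.le_def, Fin.ext_iff]
    constructor
    · rintro ⟨h1, h2, _⟩
      omega
    · intro ht
      have : t = k := Fin.ext ht
      subst this
      exact ⟨by omega, le_refl _, hb⟩
  · rw [Set.ncard_eq_zero]
    ext t
    simp only [Set.mem_setOf_eq, Set.mem_empty_iff_false, iff_false, Fin.lt_def, Fin.le_def]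
    rintro ⟨h1, h2, h3⟩
    have : t = k := Fin.ext (by omega)
    subst this
    exact hb h3

theorem circle_same_left {l : Wt N} {i j j' : Fin N} (h : IsCircle l i j)
    (h' : IsCircle l i j') : j = j' := by
  obtain ⟨a1, _, _, a4, a5⟩ := h
  obtain ⟨b1, _, _, b4, b5⟩ := h'
  rcases lt_trichotomy j j' with h | h | h
  · have := b5 j a1 h
    omega
  · exact h
  · have := a5 j' b1 h
    omega

theorem circle_nc_aux {l : Wt N} {i j k r : Fin N} (h : IsCircle l i j)
    (h' : IsCircle l k r) (hik : i < k) : j < k ∨ r < j := by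
  by_contra hc
  push Not at hc
  obtain ⟨c1, c2⟩ := hc
  obtain ⟨a1, a2, a3, a4, a5⟩ := h
  obtain ⟨b1, b2, b3, b4, b5⟩ := h'
  have hkj : k < j := lt_of_le_of_ne c1 (by rintro rfl; simp_all)
  -- predecessor of `k`
  have hik' : (i : ℕ) < k := hik
  let p : Fin N := ⟨(k : ℕ) - 1, by have := k.isLt; omega⟩
  have hpk : (p : ℕ) + 1 = k := by simp only [p]; omega
  have hip : i ≤ p := by rw [Fin.le_def]; omega
  have hpk' : p < k := by rw [Fin.lt_def]; omega
  have hp : cnt l false i p ≤ cnt l true i p := by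
    rcases eq_or_lt_of_le hip with e | e
    · rw [← e, cnt_self, cnt_self]
    · exact a5 p e (hpk'.trans hkj)
  have e1 := cnt_split l true hip hpk'.le
  have e2 := cnt_split l false hip hpk'.le
  have e3 := cnt_split l true hik.le hkj.le
  have e4 := cnt_split l false hik.le hkj.le
  rw [cnt_succ l _ hpk] at e1 e2
  simp only [b2, if_true, Bool.true_eq_false, if_false] at e1 e2
  rcases eq_or_lt_of_le c2 with e | e
  · subst e
    omega
  · have := b5 j hkj e
    omega

theorem circle_nc {l : Wt N} {i j k r : Fin N} (h : IsCircle l i j)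
    (h' : IsCircle l k r) (hne : i ≠ k) :
    j < k ∨ r < i ∨ (i < k ∧ r < j) ∨ (k < i ∧ j < r) := by
  rcases lt_or_gt_of_ne hne with e | e
  · rcases circle_nc_aux h h' e with f | f
    · exact Or.inl f
    · exact Or.inr (Or.inr (Or.inl ⟨e, f⟩))
  · rcases circle_nc_aux h' h e with f | f
    · exact Or.inr (Or.inl f)
    · exact Or.inr (Or.inr (Or.inr ⟨e, f⟩))

/-- Inversion pairs. -/
noncomputable def inv (l : Wt N) : Finset (Fin N × Fin N) :=
  Finset.univ.filter fun p => p.2 < p.1 ∧ l p.1 = true ∧ l p.2 = false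

theorem height_eq (l : Wt N) : height l = (inv l).card := by
  unfold height inv
  rw [Finset.card_filter, Fintype.sum_prod_type]
  refine Finset.sum_congr rfl fun i _ => ?_
  split_ifs with h
  · rw [Set.ncard_eq_toFinset_card', ← Finset.card_filter]
    congr 1
    ext j
    simp [h]
  · simp [h]

theorem height_swap {l : Wt N} {i j : Fin N} (hij : i < j) (hi : l i = true)
    (hj : l j = false) : height l < height (swapC l i j) := by
  rw [height_eq, height_eq]
  have hne : i ≠ j := hij.ne
  let f : Fin N × Fin N → Fin N × Fin N :=
    fun p => (Equiv.swap i j p.1, Equiv.swap i j p.2)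
  have hf : Function.Injective f := by
    rintro ⟨a, b⟩ ⟨c, d⟩ h
    simp only [f, Prod.mk.injEq, EmbeddingLike.apply_eq_iff_eq] at h
    exact Prod.ext h.1 h.2
  rw [← Finset.card_image_of_injective (inv l) hf]
  apply Finset.card_lt_card
  rw [Finset.ssubset_iff_of_subset]
  · refine ⟨(j, i), ?_, ?_⟩
    · simp [inv, swapC, hij, hi, hj, hne.symm]
    · intro h
      rw [Finset.mem_image] at h
      obtain ⟨⟨a, b⟩, h1, h2⟩ := h
      have : (a, b) = (i, j) := hf (by rw [h2]; simp [f])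
      rw [this] at h1
      simp only [inv, Finset.mem_filter] at h1
      exact absurd h1.2.1 (not_lt.mpr hij.le)
  · intro q hq
    rw [Finset.mem_image] at hq
    obtain ⟨⟨a, b⟩, h1, rfl⟩ := hq
    simp only [inv, Finset.mem_filter, Finset.mem_univ, true_and] at h1
    obtain ⟨h1, h2, h3⟩ := h1
    simp only [inv, Finset.mem_filter, Finset.mem_univ, true_and, f]
    have haj : a ≠ j := by rintro rfl; simp_all
    have hbi : b ≠ i := by rintro rfl; simp_all
    by_cases hai : a = i
    · subst hai
      have hbj : b ≠ j := (h1.trans hij).ne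
      rw [Equiv.swap_apply_left, Equiv.swap_apply_of_ne_of_ne hbi hbj]
      exact ⟨h1.trans hij, by simp [swapC, hi, hne.symm], by simp [swapC, hbi, hbj, h3]⟩
    · rw [Equiv.swap_apply_of_ne_of_ne hai haj]
      by_cases hbj : b = j
      · subst hbj
        rw [Equiv.swap_apply_right]
        exact ⟨hij.trans h1, by simp [swapC, hai, haj, h2], by simp [swapC, hj]⟩
      · rw [Equiv.swap_apply_of_ne_of_ne hbi hbj]
        exact ⟨h1, by simp [swapC, hai, haj, h2], by simp [swapC, hbi, hbj, h3]⟩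

theorem height_step {l l' : Wt N} (h : GammaStep l l') : height l < height l' := by
  obtain ⟨i, j, hc, rfl⟩ := h
  exact height_swap hc.1 hc.2.1 hc.2.2.1

/-- Data of a lower common neighbour. -/
theorem lower_data {la mu nu : Wt N} (hne : la ≠ mu) (h1 : GammaStep nu la)
    (h2 : GammaStep nu mu) : ∃ i j k r : Fin N, i < j ∧ k < r ∧
      (j < k ∨ r < i ∨ (i < k ∧ r < j) ∨ (k < i ∧ j < r)) ∧
      (la i = false ∧ mu i = true) ∧ (la j = true ∧ mu j = false) ∧
      (la k = true ∧ mu k = false) ∧ (la r = false ∧ mu r = true) ∧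
      (∀ t, t ≠ i → t ≠ j → t ≠ k → t ≠ r → la t = mu t) ∧
      nu = swapC la i j := by
  obtain ⟨i, j, hc, rfl⟩ := h1
  obtain ⟨k, r, hd, rfl⟩ := h2
  have hik : i ≠ k := by
    rintro rfl
    exact hne (by rw [circle_same_left hc hd])
  have hnc := circle_nc hc hd hik
  have hij := hc.1
  have hkr := hd.1
  obtain ⟨_, hi, hj, _⟩ := hc
  obtain ⟨_, hk, hr, _⟩ := hd
  have hir : i ≠ r := by rintro rfl; simp_all
  have hjk : j ≠ k := by rintro rfl; simp_all
  have hjr : j ≠ r := by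
    simp only [Fin.lt_def, ne_eq, Fin.ext_iff] at *
    omega
  refine ⟨i, j, k, r, hij, hkr, hnc, ?_, ?_, ?_, ?_, ?_, ?_⟩
  · simp [swapC, *]
  · simp [swapC, *, hij.ne']
  · simp [swapC, *, hik.symm, hjk.symm]
  · simp [swapC, *, hir.symm, hjr.symm, hkr.ne']
  · intro t a b c d
    simp [swapC, a, b, c, d]
  · funext t
    simp only [swapC]
    split_ifs <;> simp_all

/-- At most one length-2 path in `Γ_m^n` between distinct weights
`λ`, `μ` with `|λ| ≤ |μ|` passes through a vertex of height strictly less than `|λ|`. -/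
theorem statement3 (m n : ℕ) (hm : 1 ≤ m) (hn : 1 ≤ n) {N : ℕ} (hN : N = m + n)
    (la mu : Wt N) (hla : IsWeight m n la) (hmu : IsWeight m n mu)
    (hne : la ≠ mu) (hle : height la ≤ height mu) :
    ∀ nu nu' : Wt N,
      IsWeight m n nu → GammaAdj la nu → GammaAdj nu mu → height nu < height la →
      IsWeight m n nu' → GammaAdj la nu' → GammaAdj nu' mu → height nu' < height la →
      nu = nu' := by
  have key : ∀ nu : Wt N, GammaAdj la nu → GammaAdj nu mu → height nu < height la →
      GammaStep nu la ∧ GammaStep nu mu := by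
    intro nu h1 h2 h3
    constructor
    · rcases h1 with h | h
      · have := height_step h
        omega
      · exact h
    · rcases h2 with h | h
      · exact h
      · have := height_step h
        omega
  intro nu nu' _ a1 a2 a3 _ b1 b2 b3
  obtain ⟨s1, s2⟩ := key nu a1 a2 a3
  obtain ⟨t1, t2⟩ := key nu' b1 b2 b3
  obtain ⟨i, j, k, r, hij, hkr, hnc, hi, hj, hk, hr, ho, rfl⟩ := lower_data hne s1 s2
  obtain ⟨i', j', k', r', hij', hkr', hnc', hi', hj', hk', hr', ho', rfl⟩ :=
    lower_data hne t1 t2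
  have dU : ∀ t, la t = false → mu t = true → t = i' ∨ t = r' := by
    intro t u v
    by_contra hcon
    push Not at hcon
    have hh := ho' t hcon.1 (by rintro rfl; simp_all) (by rintro rfl; simp_all) hcon.2
    simp_all
  have dD : ∀ t, la t = true → mu t = false → t = j' ∨ t = k' := by
    intro t u v
    by_contra hcon
    push Not at hcon
    have hh := ho' t (by rintro rfl; simp_all) hcon.1 hcon.2 (by rintro rfl; simp_all)
    simp_all
  have e1 := dU i hi.1 hi.2
  have e2 := dU r hr.1 hr.2
  have e3 := dD j hj.1 hj.2
  have e4 := dD k hk.1 hk.2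
  have fin : i = i' ∧ j = j' := by
    clear dU dD ho ho'
    simp only [Fin.lt_def, Fin.ext_iff] at *
    omega
  rw [fin.1, fin.2]

end Kh
end

section
/- Let λ be a weight of type (m,n) with circles C and C′ such that C encloses C′ and some circle of λ encloses C′ and is strictly enclosed in C. Set ν = s_{C′}(λ), ν′ = s_C(λ) and μ = s_C(s_{C′}(λ)). Then C is a circle of ν, C′ is a circle of ν′ with s_{C′}(ν′) = μ, so that λ, ν, μ, ν′ form a 4-cycle in Γ_m^n; moreover the only weights adjacent in Γ_m^n to both λ and μ are ν and ν′, and the only weights adjacent to both ν and ν′ are λ and μ. -/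
open scoped Classical

namespace Kh

/-- The signed bracket count of the positions `≤ k`. -/
noncomputable def H {N : ℕ} (l : Wt N) (k : Fin N) : ℤ :=
  ∑ t : Fin N, if t ≤ k then (if l t = true then (1 : ℤ) else -1) else 0

lemma cnt_eq {N : ℕ} (l : Wt N) (b : Bool) (i j : Fin N) :
    (cnt l b i j : ℤ) = ∑ t : Fin N, if i < t ∧ t ≤ j ∧ l t = b then (1 : ℤ) else 0 := by
  unfold cnt
  rw [Set.ncard_eq_toFinset_card', Finset.sum_boole]
  congr 2
  ext t
  simp

lemma cnt_sub {N : ℕ} (l : Wt N) (i j : Fin N) (hij : i ≤ j) :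
    (cnt l true i j : ℤ) - cnt l false i j = H l j - H l i := by
  rw [cnt_eq, cnt_eq, H, H, ← Finset.sum_sub_distrib, ← Finset.sum_sub_distrib]
  refine Finset.sum_congr rfl fun t _ => ?_
  by_cases h1 : i < t
  · have h2 : ¬ t ≤ i := not_le.mpr h1
    by_cases h3 : t ≤ j <;> cases l t <;> simp [h1, h2, h3]
  · have h2 : t ≤ i := not_lt.mp h1
    have h3 : t ≤ j := h2.trans hij
    simp [h1, h2, h3]

lemma circle_iff {N : ℕ} (l : Wt N) (i j : Fin N) :
    IsCircle l i j ↔ i < j ∧ l i = true ∧ l j = false ∧ H l j = H l i - 1 ∧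
      ∀ k : Fin N, i < k → k < j → H l i ≤ H l k := by
  unfold IsCircle
  constructor
  · rintro ⟨h1, h2, h3, h4, h5⟩
    refine ⟨h1, h2, h3, ?_, fun k hk hk' => ?_⟩
    · have := cnt_sub l i j h1.le
      omega
    · have := cnt_sub l i k hk.le
      have := h5 k hk hk'
      omega
  · rintro ⟨h1, h2, h3, h4, h5⟩
    refine ⟨h1, h2, h3, ?_, fun k hk hk' => ?_⟩
    · have := cnt_sub l i j h1.le
      omega
    · have := cnt_sub l i k hk.le
      have := h5 k hk hk'
      omega

lemma H_swap {N : ℕ} (l : Wt N) (i j k : Fin N) (hij : i < j) (hi : l i = true)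
    (hj : l j = false) :
    H (swapC l i j) k = H l k - (if i ≤ k ∧ k < j then 2 else 0) := by
  have key : H (swapC l i j) k - H l k
      = (∑ t : Fin N, if t = i then (if i ≤ k then (-2 : ℤ) else 0) else 0)
        + ∑ t : Fin N, if t = j then (if j ≤ k then (2 : ℤ) else 0) else 0 := by
    rw [H, H, ← Finset.sum_sub_distrib, ← Finset.sum_add_distrib]
    refine Finset.sum_congr rfl fun t _ => ?_
    unfold swapC
    by_cases h1 : t = i
    · subst h1
      by_cases h3 : t ≤ k <;> simp [hi, hj, hij.ne, h3]
    · by_cases h2 : t = j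
      · subst h2
        by_cases h3 : t ≤ k <;> simp [hi, hj, hij.ne', h3]
      · simp [h1, h2]
  simp only [Finset.sum_ite_eq', Finset.mem_univ, if_true] at key
  split_ifs at key ⊢ <;> first | omega | (exfalso; omega)

lemma adj_data {N : ℕ} (l x : Wt N) (h : GammaAdj l x) :
    ∃ p q : Fin N, p < q ∧ l p ≠ l q ∧ x = swapC l p q ∧
      H l q = H l p + (if l q = true then 1 else -1) ∧
      ∀ k : Fin N, p < k → k < q → H l p ≤ H l k := by
  rcases h with ⟨p, q, hc, rfl⟩ | ⟨p, q, hc, rfl⟩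
  · obtain ⟨h1, h2, h3, h4, h5⟩ := (circle_iff _ _ _).1 hc
    refine ⟨p, q, h1, by simp [h2, h3], rfl, ?_, h5⟩
    simp [h3]
    omega
  · obtain ⟨h1, h2, h3, h4, h5⟩ := (circle_iff _ _ _).1 hc
    refine ⟨p, q, h1, ?_, ?_, ?_, fun k hk hk' => ?_⟩
    · simp [swapC, h1.ne', h2, h3]
    · funext t
      unfold swapC
      grind
    · rw [H_swap _ _ _ _ h1 h2 h3, H_swap _ _ _ _ h1 h2 h3]
      simp [swapC, h1.ne', h1, h2]
      omega
    · rw [H_swap _ _ _ _ h1 h2 h3, H_swap _ _ _ _ h1 h2 h3]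
      have := h5 k hk hk'
      simp [hk.le, hk', h1]
      omega

/-- Two successive swaps changing four given positions: the first pair is among them. -/
lemma pair_cases {N : ℕ} (l x y : Wt N) (p q r s a b c d : Fin N)
    (hab : a < b) (hbc : b < c) (hcd : c < d)
    (hpq : p < q) (hx : x = swapC l p q) (hy : y = swapC x r s)
    (ha : y a ≠ l a) (hb : y b ≠ l b) (hc : y c ≠ l c) (hd : y d ≠ l d) :
    (p = a ∧ q = b) ∨ (p = a ∧ q = c) ∨ (p = a ∧ q = d) ∨ (p = b ∧ q = c) ∨
      (p = b ∧ q = d) ∨ (p = c ∧ q = d) := by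
  have key : ∀ t, y t ≠ l t → t = p ∨ t = q ∨ t = r ∨ t = s := by
    intro t ht
    by_contra! hcon
    obtain ⟨h1, h2, h3, h4⟩ := hcon
    apply ht
    simp [hy, hx, swapC, h1, h2, h3, h4]
  have ka := key a ha
  have kb := key b hb
  have kc := key c hc
  have kd := key d hd
  clear key ha hb hc hd hx hy
  omega

/-- If a weight `λ` has nested circles `C = (i,j)` and `C' = (i',j')`
with an intermediate circle enclosing `C'` and strictly enclosed in `C`, then
`λ, ν = s_{C'}(λ), μ = s_C(s_{C'}(λ)), ν' = s_C(λ)` form a 4-cycle in `Γ_m^n`,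
the only common neighbours of `λ` and `μ` are `ν` and `ν'`, and the only common
neighbours of `ν` and `ν'` are `λ` and `μ`. -/
theorem statement6 (m n : ℕ) (hm : 1 ≤ m) (hn : 1 ≤ n) {N : ℕ} (hN : N = m + n)
    (la : Wt N) (hla : IsWeight m n la) (i j i' j' : Fin N)
    (hC : IsCircle la i j) (hC' : IsCircle la i' j')
    (henc : Encloses i j i' j')
    (hmid : ∃ a b : Fin N, IsCircle la a b ∧ Encloses a b i' j' ∧ Encloses i j a b) :
    IsCircle (swapC la i' j') i j ∧
    IsCircle (swapC la i j) i' j' ∧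
    swapC (swapC la i j) i' j' = swapC (swapC la i' j') i j ∧
    (la ≠ swapC la i' j' ∧ la ≠ swapC (swapC la i' j') i j ∧ la ≠ swapC la i j ∧
      swapC la i' j' ≠ swapC (swapC la i' j') i j ∧ swapC la i' j' ≠ swapC la i j ∧
      swapC (swapC la i' j') i j ≠ swapC la i j) ∧
    (GammaAdj la (swapC la i' j') ∧
      GammaAdj (swapC la i' j') (swapC (swapC la i' j') i j) ∧
      GammaAdj (swapC (swapC la i' j') i j) (swapC la i j) ∧
      GammaAdj (swapC la i j) la) ∧
    (∀ xi : Wt N, IsWeight m n xi → GammaAdj la xi →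
      GammaAdj xi (swapC (swapC la i' j') i j) →
      xi = swapC la i' j' ∨ xi = swapC la i j) ∧
    (∀ xi : Wt N, IsWeight m n xi → GammaAdj (swapC la i' j') xi →
      GammaAdj xi (swapC la i j) →
      xi = la ∨ xi = swapC (swapC la i' j') i j) := by
  obtain ⟨a, b, hab, ⟨hai, hjb⟩, ⟨hia, hbj⟩⟩ := hmid
  obtain ⟨hii, hjj⟩ := henc
  obtain ⟨c1, c2, c3, c4, c5⟩ := (circle_iff _ _ _).1 hC
  obtain ⟨d1, d2, d3, d4, d5⟩ := (circle_iff _ _ _).1 hC'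
  obtain ⟨e1, e2, e3, e4, e5⟩ := (circle_iff _ _ _).1 hab
  have n1 : i ≠ i' := hii.ne
  have n2 : i ≠ j' := (hii.trans d1).ne
  have n3 : i ≠ j := c1.ne
  have n4 : i' ≠ j' := d1.ne
  have n5 : i' ≠ j := (d1.trans hjj).ne
  have n6 : j' ≠ j := hjj.ne
  have Hn := fun k => H_swap la i' j' k d1 d2 d3
  have Hn' := fun k => H_swap la i j k c1 c2 c3
  have hν : IsCircle (swapC la i' j') i j := by
    rw [circle_iff]
    refine ⟨c1, by simp [swapC, n1, n2, c2], by simp [swapC, n5.symm, n6.symm, c3], ?_, ?_⟩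
    · rw [Hn, Hn, if_neg (by omega), if_neg (by omega)]
      omega
    · intro k hk hk'
      rw [Hn, Hn, if_neg (by omega)]
      have f1 := c5 k hk hk'
      have f2 := c5 b (by omega) hbj
      have f3 := e5 j' (by omega) hjb
      have f4 := d5 k
      split_ifs with h
      · rcases eq_or_lt_of_le h.1 with h' | h'
        · subst h'
          omega
        · have := f4 h' h.2
          omega
      · omega
  have hν' : IsCircle (swapC la i j) i' j' := by
    rw [circle_iff]
    refine ⟨d1, by simp [swapC, n1.symm, n5, d2], by simp [swapC, n2.symm, n6, d3], ?_, ?_⟩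
    · rw [Hn', Hn', if_pos (by omega), if_pos (by omega)]
      omega
    · intro k hk hk'
      rw [Hn', Hn', if_pos (by omega), if_pos (by omega)]
      have := d5 k hk hk'
      omega
  have hcomm : swapC (swapC la i j) i' j' = swapC (swapC la i' j') i j := by
    funext t
    unfold swapC
    grind
  have ne : ∀ (x y : Wt N) (t : Fin N), x t ≠ y t → x ≠ y := fun x y t h h' => h (by rw [h'])
  refine ⟨hν, hν', hcomm, ⟨?_, ?_, ?_, ?_, ?_, ?_⟩, ⟨?_, ?_, ?_, ?_⟩, ?_, ?_⟩
  · exact ne _ _ i' (by simp [swapC, d2, d3])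
  · exact ne _ _ i (by simp [swapC, c2, c3, n5.symm, n6.symm])
  · exact ne _ _ i (by simp [swapC, c2, c3])
  · exact ne _ _ i (by simp [swapC, c2, c3, n1, n2, n5.symm, n6.symm])
  · exact ne _ _ i (by simp [swapC, c2, c3, n1, n2])
  · exact ne _ _ i' (by simp [swapC, d2, d3, n1.symm, n5])
  · exact Or.inl ⟨i', j', hC', rfl⟩
  · exact Or.inl ⟨i, j, hν, rfl⟩
  · exact Or.inr ⟨i', j', hν', hcomm.symm⟩
  · exact Or.inr ⟨i, j, hC, rfl⟩
  · intro xi _ h1 h2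
    obtain ⟨p, q, p1, p2, p3, p4, p5⟩ := adj_data _ _ h1
    obtain ⟨r, s, -, -, q3, -, -⟩ := adj_data _ _ h2
    have := pair_cases la xi _ p q r s i i' j' j hii d1 hjj p1 p3 q3
      (by simp [swapC, c2, c3, n5.symm, n6.symm])
      (by simp [swapC, d2, d3, n1.symm, n5])
      (by simp [swapC, d2, d3, n2.symm, n4.symm, n6])
      (by simp [swapC, c2, c3, n1, n2, n3.symm])
    rcases this with ⟨rfl, rfl⟩ | ⟨rfl, rfl⟩ | ⟨rfl, rfl⟩ | ⟨rfl, rfl⟩ | ⟨rfl, rfl⟩ | ⟨rfl, rfl⟩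
    · exact absurd (c2.trans d2.symm) p2
    · exfalso
      have := c5 q (by omega) (by omega)
      simp [d3] at p4
      omega
    · exact Or.inr p3
    · exact Or.inl p3
    · exfalso
      have := p5 j' (by omega) (by omega)
      omega
    · exact absurd (d3.trans c3.symm) p2
  · intro xi _ h1 h2
    obtain ⟨p, q, p1, p2, p3, p4, p5⟩ := adj_data _ _ h1
    obtain ⟨r, s, -, -, q3, -, -⟩ := adj_data _ _ h2
    have v1 : swapC la i' j' i = true := by simp [swapC, c2, n1, n2]
    have v2 : swapC la i' j' i' = false := by simp [swapC, d3]
    have v3 : swapC la i' j' j' = true := by simp [swapC, d2, n4.symm]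
    have v4 : swapC la i' j' j = false := by simp [swapC, c3, n5.symm, n6.symm]
    have := pair_cases (swapC la i' j') xi _ p q r s i i' j' j hii d1 hjj p1 p3 q3
      (by rw [v1]; simp [swapC, c3])
      (by rw [v2]; simp [swapC, d2, n1.symm, n5])
      (by rw [v3]; simp [swapC, d3, n2.symm, n6])
      (by rw [v4]; simp [swapC, c2, n3.symm])
    have g1 := c5 b (by omega) hbj
    have g2 := e5 j' (by omega) hjb
    rcases this with ⟨rfl, rfl⟩ | ⟨rfl, rfl⟩ | ⟨rfl, rfl⟩ | ⟨rfl, rfl⟩ | ⟨rfl, rfl⟩ | ⟨rfl, rfl⟩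
    · exfalso
      rw [v2, Hn, Hn, if_pos (by omega), if_neg (by omega)] at p4
      simp at p4
      omega
    · exact absurd (v1.trans v3.symm) p2
    · exact Or.inr p3
    · left
      rw [p3]
      funext t
      unfold swapC
      grind
    · exact absurd (v2.trans v4.symm) p2
    · exfalso
      have := p5 b hjb hbj
      rw [Hn, Hn, if_neg (by omega), if_neg (by omega)] at this
      omega

end Kh
end
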